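/- arXiv:1010.3544 — 2 statements merged into one kernel-verified Lean document; each statement's English description precedes it below -/
import Mathlib

section
/- Let b = 1.15, a = b·(3^{1/3} − 1)^{−1}, P₃(X) = X + X² + (2/3)X³, and S(X) = P₃(X/a) − P₃(1) − 2·P₃(X/(a+b)) + (3/4)·X. Then S is strictly monotone increasing on ℝ. -/
noncomputable def bconst : ℝ := 1.15

noncomputable def aconst : ℝ := bconst * ((3 : ℝ) ^ ((1 : ℝ) / 3) - 1)⁻¹

noncomputable def P₃ (X : ℝ) : ℝ := X + X ^ 2 + (2 / 3) * X ^ 3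

noncomputable def S (X : ℝ) : ℝ :=
  P₃ (X / aconst) - P₃ 1 - 2 * P₃ (X / (aconst + bconst)) + (3 / 4) * X

lemma cubic_strictMono {A B C D : ℝ} (hA : 0 < A) (hC : B ^ 2 < 3 * A * C) :
    StrictMono fun t : ℝ => A * t ^ 3 + B * t ^ 2 + C * t + D := by
  intro x y hxy
  have hq : 0 < A * (x ^ 2 + x * y + y ^ 2) + B * (x + y) + C := by
    have h : 0 < 12 * A * (A * (x ^ 2 + x * y + y ^ 2) + B * (x + y) + C) := by
      nlinarith [sq_nonneg (3 * A * (x + y) + 2 * B), sq_nonneg (A * (x - y))]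
    exact pos_of_mul_pos_right h (by positivity)
  have := mul_pos (sub_pos.2 hxy) hq
  dsimp only
  linarith

lemma cbrt_three_pow : ((3 : ℝ) ^ ((1 : ℝ) / 3)) ^ 3 = 3 := by
  rw [← Real.rpow_natCast, ← Real.rpow_mul (by norm_num)]
  norm_num

lemma lt_cbrt_three : 1.44 < (3 : ℝ) ^ ((1 : ℝ) / 3) :=
  lt_of_pow_lt_pow_left₀ 3 (by positivity) (by rw [cbrt_three_pow]; norm_num)

lemma cbrt_three_lt : (3 : ℝ) ^ ((1 : ℝ) / 3) < 1.45 :=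
  lt_of_pow_lt_pow_left₀ 3 (by norm_num) (by rw [cbrt_three_pow]; norm_num)

lemma two_lt_aconst : 2 < aconst := by
  have h1 := lt_cbrt_three
  have h2 := cbrt_three_lt
  rw [aconst, bconst, ← div_eq_mul_inv, lt_div_iff₀ (by linarith)]
  linarith

lemma aconst_add_bconst : aconst + bconst = (3 : ℝ) ^ ((1 : ℝ) / 3) * aconst := by
  have h : (3 : ℝ) ^ ((1 : ℝ) / 3) - 1 ≠ 0 := by linarith [lt_cbrt_three]
  rw [aconst]
  field_simp
  ring

lemma S_eq_cubic (X : ℝ) :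
    S X = (2 / 9) * (X / aconst) ^ 3
      + (1 - 2 * (((3 : ℝ) ^ ((1 : ℝ) / 3))⁻¹) ^ 2) * (X / aconst) ^ 2
      + (1 - 2 * ((3 : ℝ) ^ ((1 : ℝ) / 3))⁻¹ + 3 / 4 * aconst) * (X / aconst) + -P₃ 1 := by
  have ha : aconst ≠ 0 := by linarith [two_lt_aconst]
  have hu : (((3 : ℝ) ^ ((1 : ℝ) / 3))⁻¹) ^ 3 = 1 / 3 := by
    rw [inv_pow, cbrt_three_pow, one_div]
  have hX : aconst * (X / aconst) = X := mul_div_cancel₀ X ha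
  have hdiv : X / (aconst + bconst) = ((3 : ℝ) ^ ((1 : ℝ) / 3))⁻¹ * (X / aconst) := by
    rw [aconst_add_bconst, mul_comm, div_mul_eq_div_div, div_eq_inv_mul]
  simp only [S, hdiv, P₃]
  linear_combination (-4 / 3 * (X / aconst) ^ 3) * hu - 3 / 4 * hX

/-- `S` is strictly monotone increasing on `ℝ`. -/
theorem S_strictMono : StrictMono S := by
  have ha := two_lt_aconst
  have hlo : 0.68 < ((3 : ℝ) ^ ((1 : ℝ) / 3))⁻¹ := by
    rw [lt_inv_comm₀ (by norm_num) (by positivity)]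
    exact cbrt_three_lt.trans (by norm_num)
  have hhi : ((3 : ℝ) ^ ((1 : ℝ) / 3))⁻¹ < 0.7 := by
    rw [inv_lt_comm₀ (by positivity) (by norm_num)]
    exact lt_trans (by norm_num) lt_cbrt_three
  intro x y hxy
  rw [S_eq_cubic, S_eq_cubic]
  refine cubic_strictMono (by norm_num) ?_ (div_lt_div_of_pos_right hxy (by linarith))
  generalize ((3 : ℝ) ^ ((1 : ℝ) / 3))⁻¹ = u at hlo hhi ⊢
  have hB : (1 - 2 * u ^ 2) ^ 2 < 0.1 ^ 2 := by
    apply sq_lt_sq' <;> nlinarith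
  linarith
end

section
/- Let b = 1.15, a = b·(3^{1/3} − 1)^{−1}, and P₃(X) = X + X² + (2/3)X³. There exists ε₀ > 0 such that for every real ε with 0 < ε < ε₀ and every real λ₁ with 0.6 ≤ λ₁ ≤ 0.85, one has P₃((a + λ₁)/a) − P₃(1) − 2·P₃((a + λ₁)/(a + b)) + (a + λ₁)·(3/4 + ε) < 0; in particular, inequality (2.1) of the paper fails for all such λ₁ when ε is sufficiently small. -/
/-- Numerical bounds for the real cube root of `3`. -/
theorem cbrt_three_spec :
    ((3 : ℝ) ^ ((1 : ℝ) / 3)) ^ 3 = 3 ∧ 1.44224 ≤ (3 : ℝ) ^ ((1 : ℝ) / 3) ∧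
      (3 : ℝ) ^ ((1 : ℝ) / 3) ≤ 1.44225 := by
  have hcube : ((3 : ℝ) ^ ((1 : ℝ) / 3)) ^ 3 = 3 := by
    rw [← Real.rpow_natCast, ← Real.rpow_mul (by norm_num)]
    norm_num
  have hpos : 0 ≤ (3 : ℝ) ^ ((1 : ℝ) / 3) := by positivity
  refine ⟨hcube, ?_, ?_⟩
  · exact le_of_pow_le_pow_left₀ (n := 3) (by norm_num) hpos (by rw [hcube]; norm_num)
  · exact le_of_pow_le_pow_left₀ (n := 3) (by norm_num) (by norm_num) (by rw [hcube]; norm_num)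

/-- For sufficiently small `ε > 0`, inequality (2.1) of the paper fails for all
`λ₁ ∈ [0.6, 0.85]`. -/
theorem inequality_21_fails_for_small_eps :
    ∃ ε₀ : ℝ, 0 < ε₀ ∧
      ∀ ε : ℝ, 0 < ε → ε < ε₀ →
        ∀ lam : ℝ, 0.6 ≤ lam → lam ≤ 0.85 →
          P₃ ((aconst + lam) / aconst) - P₃ 1
            - 2 * P₃ ((aconst + lam) / (aconst + bconst))
            + (aconst + lam) * (3 / 4 + ε) < 0 := by
  obtain ⟨hc, hlo, hhi⟩ := cbrt_three_spec
  refine ⟨1 / 10000, by norm_num, fun ε hε hε' lam hlam hlam' => ?_⟩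
  have hb : bconst = 1.15 := rfl
  have ha : aconst = bconst * ((3 : ℝ) ^ ((1 : ℝ) / 3) - 1)⁻¹ := rfl
  generalize (3 : ℝ) ^ ((1 : ℝ) / 3) = c at hc hlo hhi ha
  rw [hb] at ha ⊢
  have hc1 : c - 1 ≠ 0 := by linarith
  have hc0 : 0 < c := by linarith
  have hac : aconst * (c - 1) = 1.15 := by rw [ha]; field_simp
  generalize aconst = a at ha hac ⊢
  have ha_lo : 2.6 ≤ a := by nlinarith
  have ha_hi : a ≤ 2.6004 := by nlinarith
  have ha0 : 0 < a := by linarith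
  have hab : a + 1.15 = a * c := by linarith
  obtain ⟨y, hy⟩ : ∃ y, y = (a + lam) / a := ⟨_, rfl⟩
  have hy_mul : a + lam = y * a := by rw [hy]; field_simp
  have hz : (a + lam) / (a + 1.15) = y * c⁻¹ := by
    rw [hab, hy]; field_simp
  have hy_lo : 0 ≤ y := by rw [hy]; apply div_nonneg <;> linarith
  have hy_hi : y ≤ 1.32693 := by
    rw [hy, div_le_iff₀ ha0]; linarith
  have hinv_lo : 0.69336 ≤ c⁻¹ := by
    rw [le_inv_comm₀ (by norm_num) hc0]; exact hhi.trans (by norm_num)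
  have hinv3 : c⁻¹ ^ 3 = 1 / 3 := by rw [inv_pow, hc]; norm_num
  rw [hz, ← hy, hy_mul]
  generalize c⁻¹ = d at hinv_lo hinv3
  have hd2 : 0.48074 ≤ d ^ 2 := by nlinarith
  have hexpand : P₃ y - P₃ 1 - 2 * P₃ (y * d) + y * a * (3 / 4 + ε) =
      y * (1 - 2 * d + a * (3 / 4 + ε)) + y ^ 2 * (1 - 2 * d ^ 2) + 2 / 9 * y ^ 3 - 8 / 3 := by
    simp only [P₃]
    linear_combination (-4 / 3 * y ^ 3) * hinv3
  have hlin : 1 - 2 * d + a * (3 / 4 + ε) ≤ 1.56386 := by nlinarith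
  have h1 : y * (1 - 2 * d + a * (3 / 4 + ε)) ≤ 1.32693 * 1.56386 :=
    (mul_le_mul_of_nonneg_left hlin hy_lo).trans (by linarith)
  have hy2 : y ^ 2 ≤ 1.32693 ^ 2 := by gcongr
  have hy3 : y ^ 3 ≤ 1.32693 ^ 3 := by gcongr
  have h2 : y ^ 2 * (1 - 2 * d ^ 2) ≤ 1.32693 ^ 2 * 0.03852 :=
    (mul_le_mul_of_nonneg_left (show 1 - 2 * d ^ 2 ≤ 0.03852 by linarith) (sq_nonneg y)).trans
      (by linarith)
  rw [hexpand]
  norm_num at h1 h2 hy3 ⊢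
  linarith
end
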